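/- arXiv:1602.03490 — 2 statements merged into one kernel-verified Lean document; each statement's English description precedes it below -/
import Mathlib

section
/- If there exists an h×h real Hadamard matrix with h ≡ 2 (mod 3), then there exists a strongly regular graph with parameters v = h(2h+1), k = (2h−1)(h+2)/2, λ = (h−1)(h+4)/2, and μ = h(h+2)/2. -/
open Finset in
/-- A symmetric ±1 Gram matrix with the right spectrum yields the strongly regular graph. -/
lemma tr_srg_of_gram {V : Type*} [Fintype V] [DecidableEq V] (h : ℕ) (G : Matrix V V ℝ)
    (x0 : V) (hc : Fintype.card V = h * (2 * h + 1))
    (hsym : ∀ x y, G x y = G y x)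
    (hdiag : ∀ x, G x x = h + 1)
    (hoff : ∀ x y, x ≠ y → G x y = 1 ∨ G x y = -1)
    (hsq : ∀ x y, ∑ z, G x z * G y z = 3 * h * G x y)
    (hrow : ∀ x, ∑ z, G x z = 3 * h) :
    ∃ v k l m : ℕ,
      (v : ℝ) = (h : ℝ) * (2 * (h : ℝ) + 1) ∧
      (k : ℝ) = (2 * (h : ℝ) - 1) * ((h : ℝ) + 2) / 2 ∧
      (l : ℝ) = ((h : ℝ) - 1) * ((h : ℝ) + 4) / 2 ∧
      (m : ℝ) = (h : ℝ) * ((h : ℝ) + 2) / 2 ∧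
      ∃ (G : SimpleGraph (Fin v)) (_ : DecidableRel G.Adj),
        G.IsSRGWith v k l m := by
  classical
  let A : V → V → ℝ := fun x z => (G x z + 1 - (h + 2) * (if x = z then 1 else 0)) / 2
  have hcR : (Fintype.card V : ℝ) = h * (2 * h + 1) := by rw [hc]; push_cast; ring
  have hA : ∀ x z, A x z = if (x ≠ z ∧ G x z = 1) then 1 else 0 := by
    intro x z
    by_cases e : x = z
    · subst e; simp [A, hdiag]; ring
    · rcases hoff x z e with g | g <;> simp [A, e, g] <;> norm_num
  have hdeg : ∀ x, ∑ z, A x z = (2 * (h : ℝ) - 1) * ((h : ℝ) + 2) / 2 := by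
    intro x
    simp only [A]
    rw [← Finset.sum_div, Finset.sum_sub_distrib, Finset.sum_add_distrib, hrow, ← Finset.mul_sum]
    simp [hcR]; ring
  have hcom : ∀ x y, x ≠ y → ∑ z, A x z * A y z =
      (3 * h * G x y + 6 * h + h * (2 * h + 1) - 2 * (h + 2) * (G x y + 1)) / 4 := by
    intro x y hxy
    have e1 : ∀ z, A x z * A y z = (G x z * G y z + G x z + G y z + 1
        - (h + 2) * (if x = z then (G y z + 1) else 0)
        - (h + 2) * (if y = z then (G x z + 1) else 0)) / 4 := by
      intro z
      simp only [A]
      by_cases e : x = z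
      · have : ¬ y = z := by rintro rfl; exact hxy e
        simp [e, this]; ring
      · by_cases e' : y = z <;> simp [e, e'] <;> ring
    rw [Finset.sum_congr rfl (fun z _ => e1 z), ← Finset.sum_div]
    simp only [Finset.sum_sub_distrib, Finset.sum_add_distrib, ← Finset.mul_sum, hsq, hrow]
    simp [hcR, hsym y x]; ring
  -- parity
  have hpar : ∃ t, h = 2 * t := by
    have h0 := hdeg x0
    simp only [hA, Finset.sum_boole] at h0
    set k := #{z | x0 ≠ z ∧ G x0 z = 1}
    have : 2 * (k : ℤ) = (2 * h - 1) * (h + 2) := by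
      have : 2 * (k : ℝ) = (2 * h - 1) * (h + 2) := by linarith
      exact_mod_cast this
    rcases Nat.even_or_odd' h with ⟨t, ht | ht⟩
    · exact ⟨t, ht⟩
    · exfalso
      rw [ht] at this; push_cast at this
      ring_nf at this; omega
  obtain ⟨t, ht⟩ := hpar
  have htR : (h : ℝ) = 2 * t := by rw [ht]; push_cast; ring
  have ht1 : 1 ≤ t := by
    rcases Nat.eq_zero_or_pos t with r | r
    · exfalso
      have : 0 < Fintype.card V := Fintype.card_pos_iff.2 ⟨x0⟩
      rw [hc, ht, r] at this; simp at this
    · exact r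
  obtain ⟨s, rfl⟩ := Nat.exists_eq_add_of_le' ht1
  push_cast at htR
  let e : Fin (Fintype.card V) ≃ V := (Fintype.equivFin V).symm
  let Γ : SimpleGraph (Fin (Fintype.card V)) :=
    { Adj := fun a b => e a ≠ e b ∧ G (e a) (e b) = 1
      symm := ⟨fun a b hab => ⟨hab.1.symm, by rw [hsym]; exact hab.2⟩⟩
      loopless := ⟨fun a ha => ha.1 rfl⟩ }
  have hcn : ∀ a b, a ≠ b → ((Fintype.card (Γ.commonNeighbors a b) : ℕ) : ℝ) =
      ∑ z, A (e a) z * A (e b) z := by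
    intro a b _
    rw [← e.sum_comp]
    simp only [hA, ← ite_and, mul_ite, mul_one, mul_zero]
    rw [Finset.sum_boole, ← Set.toFinset_card]
    congr 2
    ext z
    simp [SimpleGraph.mem_commonNeighbors, Γ]
    tauto
  have hreg : Γ.IsRegularOfDegree ((4 * s + 3) * (s + 2)) := by
    intro a
    have := hdeg (e a)
    rw [← e.sum_comp] at this
    simp only [hA, Finset.sum_boole] at this
    have h2 : (Γ.degree a : ℝ) = ((4 * s + 3) * (s + 2) : ℕ) := by
      rw [← SimpleGraph.card_neighborFinset_eq_degree]
      trans (2 * (h : ℝ) - 1) * ((h : ℝ) + 2) / 2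
      · rw [← this]
        congr 2
        ext z; simp [Γ]
      · rw [htR]; push_cast; ring
    convert (Nat.cast_injective h2)
  have hadj : ∀ a b, Γ.Adj a b → Fintype.card (Γ.commonNeighbors a b) = (2 * s + 1) * (s + 3) := by
    intro a b hab
    have h2 : ((Fintype.card (Γ.commonNeighbors a b) : ℕ) : ℝ) = ((2 * s + 1) * (s + 3) : ℕ) := by
      rw [hcn a b hab.ne, hcom _ _ hab.1, hab.2, htR]; push_cast; ring
    convert (Nat.cast_injective h2)
  have hnadj : ∀ a b, a ≠ b → ¬ Γ.Adj a b →
      Fintype.card (Γ.commonNeighbors a b) = (s + 1) * (2 * s + 4) := by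
    intro a b hne hab
    have hne' : e a ≠ e b := fun q => hne (e.injective q)
    have hg : G (e a) (e b) = -1 := by
      rcases hoff _ _ hne' with g | g
      · exact absurd ⟨hne', g⟩ hab
      · exact g
    have h2 : ((Fintype.card (Γ.commonNeighbors a b) : ℕ) : ℝ) = ((s + 1) * (2 * s + 4) : ℕ) := by
      rw [hcn a b hne, hcom _ _ hne', hg, htR]; push_cast; ring
    convert (Nat.cast_injective h2)
  refine ⟨Fintype.card V, (4 * s + 3) * (s + 2), (2 * s + 1) * (s + 3), (s + 1) * (2 * s + 4),
    hcR, ?_, ?_, ?_, Γ, inferInstance,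
    ⟨Fintype.card_fin _, hreg, hadj, fun a b => hnadj a b⟩⟩
  · rw [htR]; push_cast; ring
  · rw [htR]; push_cast; ring
  · rw [htR]; push_cast; ring

/-- Bose's Steiner triple quasigroup on `R × ZMod 3`. -/
def trM {R : Type*} [CommRing R] [DecidableEq R] (c : R) (p q : R × ZMod 3) : R × ZMod 3 :=
  if p.2 = q.2 then (if p.1 = q.1 then p else (c * (p.1 + q.1), p.2 + 1))
  else if p.1 = q.1 then (p.1, - p.2 - q.2)
  else if q.2 = p.2 + 1 then (2 * q.1 - p.1, p.2) else (2 * p.1 - q.1, q.2)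

lemma trM_self {R : Type*} [CommRing R] [DecidableEq R] (c : R) (p : R × ZMod 3) :
    trM c p p = p := by simp [trM]

lemma trZ3 (i j : ZMod 3) (hij : i ≠ j) : (j = i + 1 ↔ ¬ i = j + 1) := by
  revert i j; decide

lemma trM_comm {R : Type*} [CommRing R] [DecidableEq R] (c : R) (p q : R × ZMod 3) :
    trM c p q = trM c q p := by
  obtain ⟨x, i⟩ := p; obtain ⟨y, j⟩ := q
  have z3 := trZ3 i j
  unfold trM
  by_cases a1 : i = j
  · subst a1
    by_cases a2 : x = y
    · simp [a2]
    · have a2' : ¬ y = x := fun q => a2 q.symm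
      simp [a2, a2', add_comm x y]
  · have a1' : ¬ j = i := fun q => a1 q.symm
    by_cases a2 : x = y
    · simp only [a1, a1', a2, if_true, if_false]
      congr 1; ring
    · have a2' : ¬ y = x := fun q => a2 q.symm
      have z3 := z3 a1
      by_cases a3 : i = j + 1
      · have a4 : ¬ j = i + 1 := fun q => z3.1 q a3
        simp only [a1, a1', a2, a2', a3, if_true, if_false]
        rw [if_neg (by rw [← a3]; exact a1), if_neg (by rw [← a3]; exact a4), if_neg (by rw [← a3]; exact a1')]
      · have a4 := z3.2 a3
        simp only [a1, a1', a2, a2', a3, if_true, if_false]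
        rw [if_pos a4]

lemma trM_invol {R : Type*} [CommRing R] [DecidableEq R] (c : R) (hc : 2 * c = 1)
    (p q : R × ZMod 3) : trM c p (trM c p q) = q := by
  obtain ⟨x, i⟩ := p; obtain ⟨y, j⟩ := q
  have h2 : ∀ a : R, 2 * a = 0 → a = 0 := fun a ha => by
    have : c * (2 * a) = 0 := by rw [ha, mul_zero]
    linear_combination this - a * hc
  have hh1 : ∀ a b : R, c * (a + b) = a → a = b := fun a b e => by
    have := congrArg (2 * ·) e
    linear_combination -this + (a + b) * hc
  have hh2 : ∀ a b : R, a = 2 * b - a → a = b := fun a b e => by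
    have := h2 (a - b) (by linear_combination e)
    linear_combination this
  have hh3 : ∀ a b : R, a = 2 * a - b → a = b := fun a b e => by
    linear_combination -e
  have e1 : ∀ a b : R, 2 * (c * (a + b)) - a = b := fun a b => by linear_combination (a + b) * hc
  have e2 : ∀ a b : R, c * (a + (2 * b - a)) = b := fun a b => by linear_combination b * hc
  have e3 : ∀ a b : R, 2 * a - (2 * a - b) = b := fun a b => by ring
  have z1 : ∀ i : ZMod 3, i ≠ i + 1 := by decide
  have z2 : ∀ i j : ZMod 3, i ≠ j → i ≠ -i-j ∧ -i - (-i-j) = j := by decide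
  have z3 := trZ3 i j
  have z4 : ∀ i j : ZMod 3, i ≠ j → j ≠ i + 1 → i = j + 1 := by decide
  unfold trM
  by_cases a1 : i = j
  · subst a1
    by_cases a2 : x = y
    · simp [a2]
    · have : ¬ x = c * (x + y) := fun e => a2 (hh1 x y e.symm)
      simp [a2, this, e1]
  · by_cases a2 : x = y
    · subst a2
      have := z2 i j a1
      simp [a1, this.1]
    · by_cases a3 : j = i + 1
      · have : ¬ x = 2 * y - x := fun e => a2 (hh2 x y e)
        subst a3
        have e2' : c * (2 * y) = y := by linear_combination y * hc
        simp [a2, this, e2']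
      · have : ¬ x = 2 * x - y := fun e => a2 (hh3 x y e)
        simp [a1, a2, a3, this]

open Finset in
lemma tr_sts (n : ℕ) (hn : n % 2 = 1) : ∃ (Pt : Type) (_ : Fintype Pt) (_ : DecidableEq Pt)
    (Blk : Finset (Finset Pt)) (P : Pt → Finset Pt), Fintype.card Pt = 3 * n ∧
      (∀ B ∈ Blk, #B = 3) ∧
      (∀ x y, x ≠ y → ∃ B₀ ∈ Blk, ∀ B ∈ Blk, (x ∈ B ∧ y ∈ B) ↔ B = B₀) ∧
      (∀ x, P x ∈ Blk) ∧ ∀ x y, x ∈ P y ↔ P x = P y := by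
  have : NeZero n := ⟨by omega⟩
  have hc : (2 : ZMod n) * (((n + 1) / 2 : ℕ) : ZMod n) = 1 := by
    have : 2 * ((n + 1) / 2) = n + 1 := by omega
    have := congrArg (Nat.cast : ℕ → ZMod n) this
    push_cast at this
    simpa using this
  set c : ZMod n := (((n + 1) / 2 : ℕ) : ZMod n)
  set m := trM c
  have hI : ∀ p q, m p (m p q) = q := trM_invol c hc
  have hC : ∀ p q, m p q = m q p := trM_comm c
  have hS : ∀ p, m p p = p := trM_self c
  have hne : ∀ p q, p ≠ q → m p q ≠ p := fun p q hpq e => by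
    have := hI p q
    rw [e, hS] at this; exact hpq this
  have hne' : ∀ p q, p ≠ q → m p q ≠ q := fun p q hpq => by
    rw [hC]; exact hne q p hpq.symm
  let Blk : Finset (Finset (ZMod n × ZMod 3)) :=
    (univ.filter (fun pq : (ZMod n × ZMod 3) × (ZMod n × ZMod 3) => pq.1 ≠ pq.2)).image
      (fun pq => {pq.1, pq.2, m pq.1 pq.2})
  have hBlk : ∀ B, B ∈ Blk ↔ ∃ p q, p ≠ q ∧ B = {p, q, m p q} := by
    intro B; simp [Blk, eq_comm]
  have huniq : ∀ B ∈ Blk, ∀ p q, p ≠ q → p ∈ B → q ∈ B → B = {p, q, m p q} := by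
    intro B hB p q hpq hp hq
    obtain ⟨a, b, hab, rfl⟩ := (hBlk B).1 hB
    have k1 : m a (m a b) = b := hI a b
    have k2 : m b (m a b) = a := by rw [hC a b]; exact hI b a
    have k3 : m (m a b) a = b := by rw [hC]; exact k1
    have k4 : m (m a b) b = a := by rw [hC]; exact k2
    have k5 : m b a = m a b := hC b a
    simp only [mem_insert, mem_singleton] at hp hq
    rcases hp with rfl | rfl | rfl <;> rcases hq with rfl | rfl | rfl <;>
      first
      | exact absurd rfl hpq
      | (ext z; simp only [mem_insert, mem_singleton, k1, k2, k3, k4, k5]; try tauto)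
  have z : ∀ i : ZMod 3, i = 0 ∨ i = 1 ∨ i = 2 := by decide
  refine ⟨ZMod n × ZMod 3, inferInstance, inferInstance, Blk,
    fun x => {(x.1, 0), (x.1, 1), (x.1, 2)}, ?_, ?_, ?_, ?_, ?_⟩
  · simp [ZMod.card, mul_comm]
  · intro B hB
    obtain ⟨a, b, hab, rfl⟩ := (hBlk B).1 hB
    exact card_eq_three.2 ⟨a, b, _, hab, (hne a b hab).symm, (hne' a b hab).symm, rfl⟩
  · intro x y hxy
    have hm : ({x, y, m x y} : Finset _) ∈ Blk := (hBlk _).2 ⟨x, y, hxy, rfl⟩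
    refine ⟨_, hm, fun B hB => ⟨fun hh => huniq B hB x y hxy hh.1 hh.2, ?_⟩⟩
    rintro rfl; simp
  · intro x
    refine (hBlk _).2 ⟨(x.1, 0), (x.1, 1), by simp, ?_⟩
    have : m (x.1, 0) (x.1, 1) = (x.1, 2) := by
      simp only [m, trM]
      simp
      decide
    rw [this]
  · rintro ⟨x, i⟩ ⟨y, j⟩
    constructor
    · intro hx
      have : x = y := by simp at hx; tauto
      rw [this]
    · intro hx
      have h0 : (x, i) ∈ ({(x, 0), (x, 1), (x, 2)} : Finset (ZMod n × ZMod 3)) := by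
        simp; exact z i
      simp only at hx
      rw [hx] at h0
      exact h0

open Finset in
lemma tr_core {Pt Blk R : Type*} [Fintype Pt] [Fintype Blk] [Fintype R] [DecidableEq Pt]
    [DecidableEq Blk] [DecidableEq R] (h : ℕ) (inc : Pt → Blk → Prop) [∀ j B, Decidable (inc j B)]
    (hcard : Fintype.card Pt + 1 = 2 * h)
    (h3 : ∀ B, #{j | inc j B} = 3)
    (h1 : ∀ x y, x ≠ y → ∃ B₀, ∀ B, (inc x B ∧ inc y B) ↔ B = B₀)
    (P : Pt → Blk) (hP : ∀ x y, inc x (P y) ↔ P x = P y)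
    (r0 : R) (r : Pt → Blk → R) (hrP : ∀ j, r j (P j) = r0)
    (hrsum : ∀ j (f : R → ℝ), ∑ B, (if inc j B then f (r j B) else 0) = ∑ a, f a)
    (hrinj : ∀ j B B', inc j B → inc j B' → r j B = r j B' → B = B')
    (H : Matrix (Option R) (Option R) ℝ) (hpm : ∀ i j, H i j = 1 ∨ H i j = -1)
    (hrow : ∀ a b, ∑ i, H a i * H b i = if a = b then (h : ℝ) else 0)
    (hcol : ∀ a b, ∑ i, H i a * H i b = if a = b then (h : ℝ) else 0)
    (hone : ∀ i, H (some r0) i = 1)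
    (K : Matrix (Option Pt) (Option Pt) ℝ) (hKpm : ∀ i j, K i j = 1 ∨ K i j = -1)
    (hKrow : ∀ a b, ∑ i, K a i * K b i = if a = b then 2 * (h : ℝ) else 0)
    (hKcol : ∀ a b, ∑ i, K i a * K i b = if a = b then 2 * (h : ℝ) else 0)
    (hKone : ∀ i, K none i = 1) :
    ∃ G : Matrix ((Pt × Option R) ⊕ Option Pt) ((Pt × Option R) ⊕ Option Pt) ℝ,
    (∀ x y, G x y = G y x) ∧
    (∀ x, G x x = h + 1) ∧
    (∀ x y, x ≠ y → G x y = 1 ∨ G x y = -1) ∧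
    (∀ x y, ∑ z, G x z * G y z = 3 * h * G x y) ∧
    (∀ x, ∑ z, G x z = 3 * h) := by
  obtain ⟨s, hs, hs0⟩ : ∃ s : ℝ, s * s = 2 ∧ s ≠ 0 := ⟨√2, by norm_num, by norm_num⟩
  obtain ⟨t, ht, ht0⟩ : ∃ s : ℝ, s * s = 3 / 2 ∧ s ≠ 0 := ⟨√(3/2), Real.mul_self_sqrt (by norm_num), by positivity⟩
  let F : Matrix (Blk ⊕ Option Pt) ((Pt × Option R) ⊕ Option Pt) ℝ := fun a x =>
    match a, x with
    | .inl B, .inl (j, i) => if inc j B then H (some (r j B)) i else 0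
    | .inl _, .inr _ => 0
    | .inr (some j'), .inl (j, i) => if j = j' then s * H none i else 0
    | .inr none, .inl _ => 0
    | .inr (some j), .inr k => s / 2 * K (some j) k
    | .inr none, .inr _ => t
  have hK0 : ∀ a, ∑ i, K (some a) i = 0 := fun a => by
    have := hKrow (some a) none; simpa [hKone] using this
  have hcR : (Fintype.card Pt : ℝ) + 1 = 2 * h := by exact_mod_cast hcard
  have hFF : F * F.transpose = (3 * h : ℝ) • (1 : Matrix _ _ ℝ) := by
    ext a b
    rw [Matrix.mul_apply]
    simp only [Matrix.transpose_apply, Matrix.smul_apply, Matrix.one_apply, Fintype.sum_sum_type,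
      Fintype.sum_prod_type]
    rcases a with B | (_ | j) <;> rcases b with B' | (_ | j')
    · simp only [F]
      have : ∀ j, ∑ i, ((if inc j B then H (some (r j B)) i else 0) *
          (if inc j B' then H (some (r j B')) i else 0)) =
          if B = B' then (if inc j B then (h : ℝ) else 0) else 0 := by
        intro j
        by_cases c1 : inc j B
        · by_cases c2 : inc j B'
          · simp only [c1, c2, if_true, hrow]
            by_cases e : B = B'
            · simp [e]
            · have : r j B ≠ r j B' := fun q => e (hrinj j B B' c1 c2 q)
              simp [e, this]
          · have : B ≠ B' := by rintro rfl; exact c2 c1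
            simp [c2, this]
        · simp [c1]
      simp only [this]
      by_cases e : B = B'
      · subst e
        simp [Finset.sum_ite, h3]
      · simp [e]
    · simp [F]
    · simp only [F]
      have : ∀ j, ∑ i, ((if inc j B then H (some (r j B)) i else 0) *
          (if j = j' then s * H none i else 0)) = 0 := by
        intro j
        by_cases c1 : inc j B
        · by_cases c2 : j = j'
          · have := hrow (some (r j B)) none
            simp only [reduceCtorEq, if_false] at this
            simp only [c1, if_true, if_pos c2, mul_left_comm _ s, ← Finset.mul_sum, this, mul_zero]
          · simp [c2]
        · simp [c1]
      rw [Finset.sum_congr rfl (fun j _ => this j)]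
      simp
    · simp [F]
    · simp only [F]
      simp [ht]
      linear_combination (3 / 2) * hcR
    · simp only [F]
      simp [← Finset.mul_sum, hK0]
    · simp only [F]
      have : ∀ k, ∑ i, ((if k = j then s * H none i else 0) *
          (if inc k B' then H (some (r k B')) i else 0)) = 0 := by
        intro k
        by_cases c1 : inc k B'
        · by_cases c2 : k = j
          · have := hrow none (some (r k B'))
            simp only [reduceCtorEq, if_false] at this
            simp only [c1, if_true, if_pos c2, mul_assoc s, ← Finset.mul_sum, this, mul_zero]
          · simp [c2]
        · simp [c1]
      rw [Finset.sum_congr rfl (fun k _ => this k)]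
      simp
    · simp only [F]
      simp [← Finset.mul_sum, ← Finset.sum_mul, hK0]
    · simp only [F]
      have e1 : ∀ k, ∑ i, ((if k = j then s * H none i else 0) *
          (if k = j' then s * H none i else 0)) =
          if k = j then (if j = j' then 2 * (h : ℝ) else 0) else 0 := by
        intro k
        by_cases c1 : k = j
        · subst c1
          by_cases c2 : k = j'
          · have := hrow none none
            simp only [if_true] at this
            simp only [if_true, if_pos c2, mul_mul_mul_comm s _ s, ← Finset.mul_sum, this, hs]
          · simp [c2]
        · simp [c1]
      rw [Finset.sum_congr rfl (fun k _ => e1 k)]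
      have e2 : ∀ x, s / 2 * K (some j) x * (s / 2 * K (some j') x) =
          (1 / 2) * (K (some j) x * K (some j') x) := fun x => by
        linear_combination (K (some j) x * K (some j') x) / 4 * hs
      rw [Finset.sum_congr rfl (fun x _ => e2 x), ← Finset.mul_sum, hKrow]
      by_cases c : j = j'
      · simp [c]; ring
      · simp [c]
  have hG : ∀ x y, (F.transpose * F) x y = ∑ B, F (.inl B) x * F (.inl B) y +
      (F (.inr none) x * F (.inr none) y + ∑ j, F (.inr (some j)) x * F (.inr (some j)) y) := by
    intro x y
    simp [Matrix.mul_apply, Fintype.sum_sum_type, Fintype.sum_option]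
  have hpm2 : ∀ i j, H i j * H i j = 1 := fun i j => by rcases hpm i j with e | e <;> simp [e]
  have hG1 : ∀ j i i', (F.transpose * F) (.inl (j, i)) (.inl (j, i')) =
      (if i = i' then (h : ℝ) else 0) + H none i * H none i' := by
    intro j i i'
    rw [hG]
    have e1 := hrsum j (fun a => H (some a) i * H (some a) i')
    have e2 := hcol i i'
    rw [Fintype.sum_option] at e2
    simp only [F]
    simp only [mul_ite, ite_mul, mul_zero, zero_mul, ← ite_and, and_self]
    simp [e1]
    linear_combination e2 + H none i * H none i' * hs
  have hG2 : ∀ j j' i i', j ≠ j' → (F.transpose * F) (.inl (j, i)) (.inl (j', i')) = 1 ∨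
      (F.transpose * F) (.inl (j, i)) (.inl (j', i')) = -1 := by
    intro j j' i i' hj
    rw [hG]
    obtain ⟨B₀, hB⟩ := h1 j j' hj
    have e1 : ∑ B, F (.inl B) (.inl (j, i)) * F (.inl B) (.inl (j', i')) =
        H (some (r j B₀)) i * H (some (r j' B₀)) i' := by
      rw [Finset.sum_eq_single B₀]
      · have := (hB B₀).2 rfl
        simp [F, this.1, this.2]
      · intro B _ hne
        have : ¬ (inc j B ∧ inc j' B) := fun q => hne ((hB B).1 q)
        simp only [F]
        by_cases c : inc j B
        · have : ¬ inc j' B := fun q => this ⟨c, q⟩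
          simp [this]
        · simp [c]
      · simp
    rw [e1]
    have e2 : ∑ k, F (.inr (some k)) (.inl (j, i)) * F (.inr (some k)) (.inl (j', i')) = 0 := by
      apply Finset.sum_eq_zero
      intro k _
      simp only [F]
      by_cases c : j = k
      · have : ¬ j' = k := fun q => hj (c.trans q.symm)
        simp [this]
      · simp [c]
    rw [e2]
    simp only [F]
    rcases hpm (some (r j B₀)) i with q | q <;> rcases hpm (some (r j' B₀)) i' with q' | q' <;>
      simp [q, q']
  have hG3 : ∀ j i k, (F.transpose * F) (.inl (j, i)) (.inr k) = H none i * K (some j) k := by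
    intro j i k
    rw [hG]
    simp only [F]
    simp
    linear_combination H none i * K (some j) k / 2 * hs
  have hG4 : ∀ k k', (F.transpose * F) (.inr k) (.inr k') = (if k = k' then (h : ℝ) else 0) + 1 := by
    intro k k'
    rw [hG]
    have e2 := hKcol k k'
    rw [Fintype.sum_option, hKone, hKone] at e2
    simp only [F]
    have : ∀ x, s / 2 * K (some x) k * (s / 2 * K (some x) k') =
        (1 / 2) * (K (some x) k * K (some x) k') := fun x => by
      linear_combination (K (some x) k * K (some x) k') / 4 * hs
    simp only [this, ← Finset.mul_sum, ht]
    split_ifs at e2 ⊢ <;> simp <;> linarith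
  have hsym : ∀ x y, (F.transpose * F) x y = (F.transpose * F) y x := by
    intro x y
    rw [hG, hG]; simp only [mul_comm]
  refine ⟨F.transpose * F, hsym, ?_, ?_, ?_, ?_⟩
  · rintro (⟨j, i⟩ | k)
    · rw [hG1]; simp [hpm2]
    · rw [hG4]; simp
  · rintro (⟨j, i⟩ | k) (⟨j', i'⟩ | k') hne
    · by_cases c : j = j'
      · subst c
        have : i ≠ i' := by rintro rfl; exact hne rfl
        rw [hG1]
        rcases hpm none i with q | q <;> rcases hpm none i' with q' | q' <;> simp [q, q', this]
      · exact hG2 _ _ _ _ c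
    · rw [hG3]
      rcases hpm none i with q | q <;> rcases hKpm (some j) k' with q' | q' <;> simp [q, q']
    · rw [hsym, hG3]
      rcases hpm none i' with q | q <;> rcases hKpm (some j') k with q' | q' <;> simp [q, q']
    · have : k ≠ k' := by rintro rfl; exact hne rfl
      rw [hG4]; simp [this]
  · intro x y
    have e : (F.transpose * F) * (F.transpose * F) = (3 * h : ℝ) • (F.transpose * F) := by
      rw [Matrix.mul_assoc, ← Matrix.mul_assoc F, hFF]; simp
    have := congrFun (congrFun e x) y
    rw [Matrix.mul_apply] at this
    simpa [hsym y] using this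
  · classical
    let w : Blk ⊕ Option Pt → ℝ := fun a => match a with
      | .inl B => if ∃ j, B = P j then 1 else 0
      | .inr none => 1 / t
      | .inr (some _) => 0
    have hw : Matrix.mulVec F.transpose w = fun _ => 1 := by
      funext x
      simp only [Matrix.mulVec, dotProduct, Fintype.sum_sum_type, Fintype.sum_option,
        Matrix.transpose_apply]
      rcases x with ⟨j, i⟩ | k
      · rw [Finset.sum_eq_single (P j)]
        · have : inc j (P j) := (hP j j).2 rfl
          simp [F, w, this, hrP, hone]
        · intro B _ hne
          by_cases c : ∃ j', B = P j'
          · obtain ⟨j', rfl⟩ := c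
            have : ¬ inc j (P j') := fun q => hne ((hP _ _).1 q).symm
            simp [F, this]
          · simp [w, c]
        · simp
      · simp [F, w, ht0]
    intro x
    have e : Matrix.mulVec (F.transpose * F) (fun _ => 1) = (3 * h : ℝ) • fun _ => (1 : ℝ) := by
      rw [← hw, Matrix.mulVec_mulVec, Matrix.mul_assoc, hFF]
      simp [Matrix.smul_mulVec]
    have := congrFun e x
    simpa [Matrix.mulVec, dotProduct] using this

lemma tr_normalize {ι κ : Type*} [Fintype ι] [DecidableEq ι] [Fintype κ] [DecidableEq κ] (e : ι ≃ κ)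
    (c : ℝ) (hc : c ≠ 0) (H : Matrix κ κ ℝ)
    (hpm : ∀ i j, H i j = 1 ∨ H i j = -1)
    (hH : H * H.transpose = c • (1 : Matrix κ κ ℝ)) (r : ι) :
    ∃ K : Matrix ι ι ℝ, (∀ i j, K i j = 1 ∨ K i j = -1) ∧
      (∀ a b, ∑ i, K a i * K b i = if a = b then c else 0) ∧
      (∀ a b, ∑ i, K i a * K i b = if a = b then c else 0) ∧
      (∀ i, K r i = 1) := by
  have hH' : H.transpose * H = c • (1 : Matrix κ κ ℝ) := by
    have : H * (c⁻¹ • H.transpose) = 1 := by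
      rw [Matrix.mul_smul, hH, smul_smul, inv_mul_cancel₀ hc, one_smul]
    have := mul_eq_one_comm.1 this
    rw [Matrix.smul_mul] at this
    rw [← this, smul_smul, mul_inv_cancel₀ hc, one_smul]
  have h2 : ∀ i j, H i j * H i j = 1 := fun i j => by rcases hpm i j with e | e <;> simp [e]
  refine ⟨fun a i => H (e a) (e i) * H (e r) (e i), ?_, ?_, ?_, ?_⟩
  · intro i j
    rcases hpm (e i) (e j) with q | q <;> rcases hpm (e r) (e j) with q' | q' <;> simp [q, q']
  · intro a b
    have := congrFun (congrFun hH (e a)) (e b)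
    rw [Matrix.mul_apply, ← e.sum_comp] at this
    simp only [Matrix.transpose_apply, Matrix.smul_apply, Matrix.one_apply, e.apply_eq_iff_eq,
      smul_eq_mul, mul_ite, mul_one, mul_zero] at this
    rw [← this]
    refine Finset.sum_congr rfl fun i _ => ?_
    linear_combination H (e a) (e i) * H (e b) (e i) * h2 (e r) (e i)
  · intro a b
    have := congrFun (congrFun hH' (e a)) (e b)
    rw [Matrix.mul_apply, ← e.sum_comp] at this
    simp only [Matrix.transpose_apply, Matrix.smul_apply, Matrix.one_apply, e.apply_eq_iff_eq,
      smul_eq_mul, mul_ite, mul_one, mul_zero] at this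
    have e1 : ∀ i, H (e i) (e a) * H (e r) (e a) * (H (e i) (e b) * H (e r) (e b)) =
        (H (e r) (e a) * H (e r) (e b)) * (H (e i) (e a) * H (e i) (e b)) := fun i => by ring
    simp only [e1, ← Finset.mul_sum, this]
    by_cases q : a = b
    · subst q; simp [h2]
    · simp [q]
  · intro i; exact h2 _ _

lemma tr_double {κ : Type*} [Fintype κ] [DecidableEq κ]
    (c : ℝ) (H : Matrix κ κ ℝ)
    (hpm : ∀ i j, H i j = 1 ∨ H i j = -1)
    (hH : H * H.transpose = c • (1 : Matrix κ κ ℝ)) :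
    ∃ K : Matrix (κ ⊕ κ) (κ ⊕ κ) ℝ, (∀ i j, K i j = 1 ∨ K i j = -1) ∧
      K * K.transpose = (2 * c) • (1 : Matrix (κ ⊕ κ) (κ ⊕ κ) ℝ) := by
  refine ⟨Matrix.fromBlocks H H H (-H), ?_, ?_⟩
  · rintro (i | i) (j | j) <;> rcases hpm i j with q | q <;> simp [q]
  · rw [Matrix.fromBlocks_transpose, Matrix.fromBlocks_multiply, ← Matrix.fromBlocks_one,
      Matrix.fromBlocks_smul]
    simp [hH, two_mul, add_smul]

open Finset in
lemma tr_blocks_through {Pt : Type*} [Fintype Pt] [DecidableEq Pt] (Blk : Finset (Finset Pt))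
    (h3 : ∀ B ∈ Blk, #B = 3)
    (h1 : ∀ x y, x ≠ y → ∃ B₀ ∈ Blk, ∀ B ∈ Blk, (x ∈ B ∧ y ∈ B) ↔ B = B₀) (j : Pt) :
    Fintype.card Pt = 2 * #{B ∈ Blk | j ∈ B} + 1 := by
  have e : univ.erase j = ({B ∈ Blk | j ∈ B}).biUnion (fun B => B.erase j) := by
    ext x
    simp only [mem_erase, mem_univ, and_true, mem_biUnion, mem_filter]
    constructor
    · intro hx
      obtain ⟨B₀, hB, hB'⟩ := h1 x j hx
      have := (hB' B₀ hB).2 rfl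
      exact ⟨B₀, ⟨hB, this.2⟩, hx, this.1⟩
    · rintro ⟨B, _, hx, _⟩; exact hx
  have := congrArg card e
  rw [card_biUnion, card_erase_of_mem (mem_univ _), card_univ, sum_const_nat (m := 2)] at this
  · have : 0 < Fintype.card Pt := Fintype.card_pos_iff.2 ⟨j⟩
    omega
  · intro B hB
    rw [mem_filter] at hB
    rw [card_erase_of_mem hB.2, h3 B hB.1]
  · intro B hB B' hB' hne
    rw [mem_coe, mem_filter] at hB hB'
    change Disjoint (B.erase j) (B'.erase j)
    rw [Finset.disjoint_left]
    intro x hx hx'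
    rw [mem_erase] at hx hx'
    obtain ⟨B₀, _, hB₀⟩ := h1 x j hx.1
    exact hne (((hB₀ B hB.1).1 ⟨hx.2, hB.2⟩).trans ((hB₀ B' hB'.1).1 ⟨hx'.2, hB'.2⟩).symm)


open Finset in
lemma tr_main (h : ℕ) (hmod : h % 3 = 2)
    (H : Matrix (Fin h) (Fin h) ℝ)
    (hentries : ∀ i j, H i j = 1 ∨ H i j = -1)
    (hHad : H * H.transpose = (h : ℝ) • (1 : Matrix (Fin h) (Fin h) ℝ)) :
    ∃ v k l m : ℕ,
      (v : ℝ) = (h : ℝ) * (2 * (h : ℝ) + 1) ∧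
      (k : ℝ) = (2 * (h : ℝ) - 1) * ((h : ℝ) + 2) / 2 ∧
      (l : ℝ) = ((h : ℝ) - 1) * ((h : ℝ) + 4) / 2 ∧
      (m : ℝ) = (h : ℝ) * ((h : ℝ) + 2) / 2 ∧
      ∃ (G : SimpleGraph (Fin v)) (_ : DecidableRel G.Adj),
        G.IsSRGWith v k l m := by
  classical
  obtain ⟨Pt, _, _, Blk, P, hcard, h3, h1, hPB, hP⟩ := tr_sts ((2 * h - 1) / 3) (by omega)
  have hc : Fintype.card Pt + 1 = 2 * h := by omega
  have hh0 : (h : ℝ) ≠ 0 := by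
    have : h ≠ 0 := by omega
    exact_mod_cast this
  have hth : ∀ j, #{B ∈ Blk | j ∈ B} = h - 1 := fun j => by
    have := tr_blocks_through Blk h3 h1 j
    omega
  let r0 : Fin (h - 1) := ⟨0, by omega⟩
  -- labelling of the blocks through each point by the rows of the Hadamard matrix
  have hE : ∀ j, ∃ e : {B : Blk // j ∈ B.1} ≃ Fin (h - 1),
      e ⟨⟨P j, hPB j⟩, (hP j j).2 rfl⟩ = r0 := by
    intro j
    have : Fintype.card {B : Blk // j ∈ B.1} = Fintype.card (Fin (h - 1)) := by
      rw [Fintype.card_fin, ← hth j, Fintype.card_subtype]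
      refine Finset.card_bij (fun B _ => B.1) ?_ ?_ ?_
      · intro B hB; simp at hB; simp [hB]
      · intro B _ B' _ q; exact Subtype.ext q
      · intro B hB
        rw [mem_filter] at hB
        exact ⟨⟨B, hB.1⟩, by simp [hB.2], rfl⟩
    let e := Fintype.equivOfCardEq this
    exact ⟨e.trans (Equiv.swap (e ⟨⟨P j, hPB j⟩, (hP j j).2 rfl⟩) r0), by simp⟩
  choose e he using hE
  have hcO : Fintype.card (Option (Fin (h - 1))) = Fintype.card (Fin h) := by simp; omega
  obtain ⟨H', a1, a2, a3, a4⟩ := tr_normalize (Fintype.equivOfCardEq hcO) (h : ℝ) hh0 H hentries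
    hHad (some r0)
  obtain ⟨K0, k1, k2⟩ := tr_double (h : ℝ) H hentries hHad
  have hcK : Fintype.card (Option Pt) = Fintype.card (Fin h ⊕ Fin h) := by simp; omega
  obtain ⟨K, b1, b2, b3, b4⟩ := tr_normalize (Fintype.equivOfCardEq hcK) (2 * h : ℝ)
    (by simpa using hh0) K0 k1 k2 none
  obtain ⟨G, g1, g2, g3, g4, g5⟩ := tr_core (Pt := Pt) (Blk := Blk) (R := Fin (h - 1)) h
    (fun j B => j ∈ B.1) hc
    (fun B => by
      rw [← h3 B.1 B.2]; congr 1; ext; simp)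
    (fun x y hxy => by
      obtain ⟨B₀, hB, hB'⟩ := h1 x y hxy
      exact ⟨⟨B₀, hB⟩, fun B => by rw [hB' B.1 B.2, Subtype.ext_iff]⟩)
    (fun j => ⟨P j, hPB j⟩)
    (fun x y => by rw [Subtype.ext_iff]; exact hP x y)
    r0 (fun j B => if hB : j ∈ B.1 then e j ⟨B, hB⟩ else r0)
    (fun j => by
      have : j ∈ P j := (hP j j).2 rfl
      simp [he])
    (fun j f => by
      rw [← (e j).sum_comp, ← Finset.sum_filter]
      rw [Finset.sum_subtype (p := fun B : Blk => j ∈ B.1) _ (by simp)]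
      refine Finset.sum_congr rfl fun B _ => ?_
      simp [B.2])
    (fun j B B' c1 c2 q => by
      simp only [c1, c2, dif_pos] at q
      have := (e j).injective q
      exact congrArg Subtype.val this)
    H' a1 a2 a3 a4 K b1 b2 b3 b4
  refine tr_srg_of_gram h G (.inr none) ?_ g1 g2 g3 g4 g5
  simp
  have : Fintype.card Pt = 2 * h - 1 := by omega
  rw [this]
  obtain ⟨t, rfl⟩ : ∃ t, h = t + 1 := ⟨h - 1, by omega⟩
  have : 2 * (t + 1) - 1 = 2 * t + 1 := by omega
  rw [this, Nat.add_sub_cancel]; ring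


/-- If there is an `h × h` real Hadamard matrix with `h ≡ 2 (mod 3)`, then there is a
strongly regular graph with parameters `v = h(2h+1)`, `k = (2h−1)(h+2)/2`,
`λ = (h−1)(h+4)/2`, and `μ = h(h+2)/2`. -/
theorem real_tremain_gs_srg (h : ℕ) (hmod : h % 3 = 2)
    (H : Matrix (Fin h) (Fin h) ℝ)
    (hentries : ∀ i j, H i j = 1 ∨ H i j = -1)
    (hHad : H * H.transpose = (h : ℝ) • (1 : Matrix (Fin h) (Fin h) ℝ)) :
    ∃ v k l m : ℕ,
      (v : ℝ) = (h : ℝ) * (2 * (h : ℝ) + 1) ∧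
      (k : ℝ) = (2 * (h : ℝ) - 1) * ((h : ℝ) + 2) / 2 ∧
      (l : ℝ) = ((h : ℝ) - 1) * ((h : ℝ) + 4) / 2 ∧
      (m : ℝ) = (h : ℝ) * ((h : ℝ) + 2) / 2 ∧
      ∃ (G : SimpleGraph (Fin v)) (_ : DecidableRel G.Adj),
        G.IsSRGWith v k l m := by
  exact tr_main h hmod H hentries hHad
end

section
/- If p is prime and k ≥ m ≥ 0 are integers, then there exists an H(p, 2^m · p^k) matrix, i.e., a (2^m p^k)×(2^m p^k) matrix H all of whose entries are p-th roots of unity and which satisfies H H* = 2^m p^k · I. -/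
/-- Existence of a Butson matrix of order `n`. -/
def BEx (p n : ℕ) : Prop :=
  ∃ H : Matrix (Fin n) (Fin n) ℂ,
    (∀ i j, H i j ^ p = 1) ∧ H * H.conjTranspose = (n : ℂ) • (1 : Matrix (Fin n) (Fin n) ℂ)

theorem BEx.of_type {p n : ℕ} {ι : Type} [Fintype ι] [DecidableEq ι] (hn : Fintype.card ι = n)
    (H : Matrix ι ι ℂ) (h1 : ∀ i j, H i j ^ p = 1)
    (h2 : H * H.conjTranspose = (n : ℂ) • (1 : Matrix ι ι ℂ)) : BEx p n := by
  let e := Fintype.equivFinOfCardEq hn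
  refine ⟨H.submatrix e.symm e.symm, fun i j => h1 _ _, ?_⟩
  rw [Matrix.conjTranspose_submatrix, Matrix.submatrix_mul_equiv, h2]
  ext i j
  simp [Matrix.one_apply]

theorem BEx.mul {p a b : ℕ} (ha : BEx p a) (hb : BEx p b) : BEx p (a * b) := by
  obtain ⟨A, hA, hA'⟩ := ha
  obtain ⟨B, hB, hB'⟩ := hb
  refine BEx.of_type (ι := Fin a × Fin b) (by simp) (Matrix.kroneckerMap (· * ·) A B) ?_ ?_
  · intro i j
    simp [mul_pow, hA, hB]
  · rw [Matrix.conjTranspose_kronecker, ← Matrix.mul_kronecker_mul, hA', hB',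
      Matrix.smul_kronecker, Matrix.kronecker_smul, Matrix.one_kronecker_one, smul_smul]
    push_cast
    rfl

theorem BEx.one (p : ℕ) : BEx p 1 :=
  ⟨1, by intro i j; rw [Subsingleton.elim i j, Matrix.one_apply_eq, one_pow], by simp⟩

theorem BEx.pow {p a : ℕ} (ha : BEx p a) (k : ℕ) : BEx p (a ^ k) := by
  induction k with
  | zero => simpa using BEx.one p
  | succ k ih => rw [pow_succ]; exact ih.mul ha

theorem BEx.of_exp {p n : ℕ} [Fact p.Prime] {ι : Type} [Fintype ι] [DecidableEq ι]
    (hn : Fintype.card ι = n) (Q : ι → ι → ZMod p)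
    (h : ∀ i i', i ≠ i' → ∑ j, ZMod.stdAddChar (Q i j - Q i' j) = 0) : BEx p n := by
  refine BEx.of_type hn (Matrix.of fun i j => ZMod.stdAddChar (Q i j)) ?_ ?_
  · intro i j
    rw [Matrix.of_apply, ← AddChar.map_nsmul_eq_pow]
    simp
  · ext i i'
    have : ∀ j, ZMod.stdAddChar (Q i j) * star (ZMod.stdAddChar (Q i' j))
        = ZMod.stdAddChar (Q i j - Q i' j) := by
      intro j
      rw [sub_eq_add_neg, AddChar.map_add_eq_mul, AddChar.map_neg_eq_conj]
      rfl
    simp only [Matrix.mul_apply, Matrix.conjTranspose_apply, Matrix.of_apply, this, Matrix.smul_apply,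
      Matrix.one_apply]
    by_cases hi : i = i'
    · subst hi
      simp [hn]
    · simp [hi, h i i' hi]

theorem sum_lin {p : ℕ} [Fact p.Prime] (b c : ZMod p) (hb : b ≠ 0) :
    ∑ j : ZMod p, ZMod.stdAddChar (j * b + c) = 0 := by
  simp only [AddChar.map_add_eq_mul, ← Finset.sum_mul]
  rw [AddChar.sum_mulShift b (ZMod.isPrimitive_stdAddChar p)]
  simp [hb]

theorem BEx.self (p : ℕ) [Fact p.Prime] : BEx p p := by
  refine BEx.of_exp (ι := ZMod p) (ZMod.card p) (fun i j => i * j) ?_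
  intro i i' h
  rw [← sum_lin (i - i') 0 (sub_ne_zero.2 h)]
  exact Finset.sum_congr rfl fun j _ => by congr 1; ring

theorem sum_sq {p : ℕ} [Fact p.Prime] (hp : p ≠ 2) (c : ZMod p) :
    ∑ x : ZMod p, ZMod.stdAddChar (c * x ^ 2)
      = ∑ a : ZMod p, ((quadraticChar (ZMod p) a + 1 : ℤ) : ℂ) * ZMod.stdAddChar (c * a) := by
  have hF : ringChar (ZMod p) ≠ 2 := by rwa [ZMod.ringChar_zmod_n]
  rw [← Finset.sum_fiberwise_of_maps_to (s := Finset.univ) (t := Finset.univ)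
    (g := fun x : ZMod p => x ^ 2) (fun _ _ => Finset.mem_univ _)]
  refine Finset.sum_congr rfl fun a _ => ?_
  rw [← quadraticChar_card_sqrts hF a]
  rw [Finset.sum_congr rfl (g := fun _ => ZMod.stdAddChar (c * a))
    (fun x hx => by rw [(Finset.mem_filter.1 hx).2])]
  rw [Finset.sum_const, nsmul_eq_mul]
  congr 2
  congr 1
  ext x
  simp

theorem sum_sq_add {p : ℕ} [Fact p.Prime] (hp : p ≠ 2) (n : ZMod p)
    (hn : quadraticChar (ZMod p) n = -1) :
    ∑ x : ZMod p, ZMod.stdAddChar (x ^ 2) + ∑ x : ZMod p, ZMod.stdAddChar (n * x ^ 2) = 0 := by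
  have hn0 : n ≠ 0 := by rintro rfl; simp at hn
  have h1 := sum_sq hp (1 : ZMod p)
  simp only [one_mul] at h1
  rw [h1, sum_sq hp n, ← Equiv.sum_comp (Equiv.mulLeft₀ n hn0), ← Finset.sum_add_distrib]
  have h0 := sum_lin n 0 hn0
  rw [← mul_zero (2 : ℂ), ← h0, Finset.mul_sum]
  refine Finset.sum_congr rfl fun a _ => ?_
  simp only [Equiv.mulLeft₀_apply, map_mul, hn, add_zero, mul_comm a n]
  push_cast
  ring

theorem BEx.two_mul_self (p : ℕ) [hF : Fact p.Prime] : BEx p (2 * p) := by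
  by_cases hp : p = 2
  · subst hp
    exact (BEx.self 2).mul (BEx.self 2)
  have hF : ringChar (ZMod p) ≠ 2 := by rwa [ZMod.ringChar_zmod_n]
  have h2 : (2 : ZMod p) ≠ 0 := Ring.two_ne_zero hF
  obtain ⟨n, hn⟩ := quadraticChar_exists_neg_one hF
  have hn0 : n ≠ 0 := by rintro rfl; simp at hn
  let Q : ZMod p ⊕ ZMod p → ZMod p ⊕ ZMod p → ZMod p := fun r c =>
    match r, c with
    | .inl i, .inl j => j ^ 2 + 2 * i * j + i ^ 2
    | .inl i, .inr j => n * j ^ 2 + 2 * i * j + i ^ 2 * n⁻¹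
    | .inr i, .inl j => 2 * i * j - i ^ 2
    | .inr i, .inr j => 2 * n * i * j - n * i ^ 2
  have key : ∀ i i' : ZMod p,
      ∑ j, ZMod.stdAddChar (Q (.inl i) j - Q (.inr i') j) = 0 := by
    intro i i'
    rw [Fintype.sum_sum_type]
    have e1 : ∀ j : ZMod p, ZMod.stdAddChar (Q (.inl i) (.inl j) - Q (.inr i') (.inl j))
        = ZMod.stdAddChar ((j + (i - i')) ^ 2) * ZMod.stdAddChar (2 * i * i') := by
      intro j
      rw [← AddChar.map_add_eq_mul]
      congr 1
      simp only [Q]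
      ring
    have e2 : ∀ j : ZMod p, ZMod.stdAddChar (Q (.inl i) (.inr j) - Q (.inr i') (.inr j))
        = ZMod.stdAddChar (n * (j + (i * n⁻¹ - i')) ^ 2) * ZMod.stdAddChar (2 * i * i') := by
      intro j
      rw [← AddChar.map_add_eq_mul]
      congr 1
      simp only [Q]
      field_simp
      ring
    simp only [e1, e2, ← Finset.sum_mul]
    rw [← add_mul, show ∑ j : ZMod p, ZMod.stdAddChar ((j + (i - i')) ^ 2) = _ from
        Equiv.sum_comp (Equiv.addRight (i - i')) (fun x : ZMod p => ZMod.stdAddChar (x ^ 2)),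
      show ∑ j : ZMod p, ZMod.stdAddChar (n * (j + (i * n⁻¹ - i')) ^ 2) = _ from
        Equiv.sum_comp (Equiv.addRight (i * n⁻¹ - i'))
          (fun x : ZMod p => ZMod.stdAddChar (n * x ^ 2)),
      sum_sq_add hp n hn, zero_mul]
  refine BEx.of_exp (ι := ZMod p ⊕ ZMod p) (by simp [two_mul]) Q ?_
  rintro (i | i) (i' | i') h
  · have hi : i - i' ≠ 0 := sub_ne_zero.2 fun h' => h (by rw [h'])
    have a1 := sum_lin (2 * (i - i')) (i ^ 2 - i' ^ 2) (mul_ne_zero h2 hi)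
    have a2 := sum_lin (2 * (i - i')) (i ^ 2 * n⁻¹ - i' ^ 2 * n⁻¹) (mul_ne_zero h2 hi)
    rw [Fintype.sum_sum_type, ← add_zero (0 : ℂ)]
    nth_rw 1 [← a1]
    rw [← a2]
    congr 1 <;> exact Finset.sum_congr rfl fun j _ => by congr 1; simp only [Q]; ring
  · exact key i i'
  · have := congrArg (starRingEnd ℂ) (key i' i)
    rw [map_sum, map_zero] at this
    rw [← this]
    refine Finset.sum_congr rfl fun j _ => ?_
    rw [← AddChar.map_neg_eq_conj, neg_sub]
  · have hi : i - i' ≠ 0 := sub_ne_zero.2 fun h' => h (by rw [h'])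
    have a1 := sum_lin (2 * (i - i')) (-i ^ 2 + i' ^ 2) (mul_ne_zero h2 hi)
    have a2 := sum_lin (2 * n * (i - i')) (-n * i ^ 2 + n * i' ^ 2)
      (mul_ne_zero (mul_ne_zero h2 hn0) hi)
    rw [Fintype.sum_sum_type, ← add_zero (0 : ℂ)]
    nth_rw 1 [← a1]
    rw [← a2]
    congr 1 <;> exact Finset.sum_congr rfl fun j _ => by congr 1; simp only [Q]; ring

/-- **Butson's construction.** If `p` is prime and `k ≥ m ≥ 0`, then there exists an
`H(p, 2^m p^k)` matrix: a `(2^m p^k) × (2^m p^k)` complex matrix `H` all of whose entries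
are `p`-th roots of unity and which satisfies `H H* = 2^m p^k · I`. -/
theorem butson_hadamard_exists (p m k : ℕ) (hp : p.Prime) (hmk : m ≤ k) :
    ∃ H : Matrix (Fin (2 ^ m * p ^ k)) (Fin (2 ^ m * p ^ k)) ℂ,
      (∀ i j, H i j ^ p = 1) ∧
      H * H.conjTranspose =
        ((2 ^ m * p ^ k : ℕ) : ℂ) •
          (1 : Matrix (Fin (2 ^ m * p ^ k)) (Fin (2 ^ m * p ^ k)) ℂ) := by
  have : Fact p.Prime := ⟨hp⟩
  have h := ((BEx.two_mul_self p).pow m).mul ((BEx.self p).pow (k - m))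
  have e : (2 * p) ^ m * p ^ (k - m) = 2 ^ m * p ^ k := by
    rw [mul_pow, mul_assoc, ← pow_add, Nat.add_sub_cancel' hmk]
  rw [e] at h
  exact h
end
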